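/- arXiv:2308.04921 — 2 statements merged into one kernel-verified Lean document; each statement's English description precedes it below -/
import Mathlib

section
/- Let w : [0,T) → ℝ^N with T ∈ (0,∞] be a regular reparametrized gradient flow under Assumptions (B1), (A2), (A3), and let F(z̃) = ⟨1, H(z̃)⟩ where H is a continuous antiderivative of a continuous antiderivative h of h'(z̃) = ([ρ_rp^{-1}]'(z̃))². Then for every z̃ ∈ D_rp^N and every t ∈ (0,T) outside the finite set T₀ of times at which h'∘w̃ is not well-defined, the function t ↦ D_F(z̃, w̃(t)) is differentiable at t with (d/dt) D_F(z̃, w̃(t)) ≤ 𝓛̃(z̃) − 𝓛̃(w̃(t)). In particular, if T = ∞ and 𝓛̃(z̃) = 0, then lim_{t→∞} D_F(z̃, w̃(t)) exists. -/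
open Filter Topology Set
open scoped ENNReal

noncomputable section

/-- Euclidean gradient of `f : ℝ^k → ℝ`: coordinatewise the Fréchet derivative applied to
the standard basis vectors. -/
def grad {k : ℕ} (f : (Fin k → ℝ) → ℝ) (x : Fin k → ℝ) : Fin k → ℝ :=
  fun i => fderiv ℝ f x (Pi.single i 1)

/-- `w` solves the gradient-flow ODE `w' = -∇F(w)` on `[0, T)`, where `T ∈ (0, ∞]` is coded
as an element of `ℝ≥0∞`. -/
def IsGradFlowOn {k : ℕ} (F : (Fin k → ℝ) → ℝ) (T : ℝ≥0∞) (w : ℝ → Fin k → ℝ) : Prop :=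
  ∀ t : ℝ, 0 ≤ t → ENNReal.ofReal t < T →
    HasDerivWithinAt w (-(grad F (w t))) (Set.Ici 0) t

/-- A reparametrized flow is regular if `ρ'` vanishes at some coordinate of `w t` for only
finitely many times `t` in the domain `[0, T)`. -/
def RegularFlow {k : ℕ} (ρ : ℝ → ℝ) (T : ℝ≥0∞) (w : ℝ → Fin k → ℝ) : Prop :=
  {t : ℝ | 0 ≤ t ∧ ENNReal.ofReal t < T ∧ ∃ i, deriv ρ (w t i) = 0}.Finite

/-- The filter of "`t → T` from within `[0,T)`", with `T = ∞` meaning `t → ∞`. -/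
def endFilter (T : ℝ≥0∞) : Filter ℝ :=
  if T = ⊤ then Filter.atTop else nhdsWithin T.toReal (Set.Iio T.toReal)

/-- Entrywise ℓp-norm on `ℝ^k`. -/
def lpNorm {k : ℕ} (p : ℝ) (z : Fin k → ℝ) : ℝ := (∑ i, |z i| ^ p) ^ (1 / p)

/-- Euclidean norm on `ℝ^k`. -/
def euclNorm {k : ℕ} (z : Fin k → ℝ) : ℝ := Real.sqrt (∑ i, (z i) ^ 2)

/-- Bregman divergence associated with `F(z) = ∑ i, H (z i)`, whose gradient is `h = H'`
applied entrywise. -/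
def bregman {k : ℕ} (H h : ℝ → ℝ) (p q : Fin k → ℝ) : ℝ :=
  (∑ i, H (p i)) - (∑ i, H (q i)) - ∑ i, h (q i) * (p i - q i)

/-- Assumption (A3) on the loss function: continuously differentiable, convex in the first
argument, with minimum `0` attained exactly on the diagonal. -/
structure LossA3 {m : ℕ} (L : (Fin m → ℝ) → (Fin m → ℝ) → ℝ) : Prop where
  contDiff : ContDiff ℝ 1 (Function.uncurry L)
  convexOn_fst : ∀ y, ConvexOn ℝ Set.univ fun z => L z y
  nonneg : ∀ z z', 0 ≤ L z z'
  eq_zero_iff : ∀ z z', L z z' = 0 ↔ z = z'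

/-- Assumption (A1) on the link function. -/
structure LinkA1 {m : ℕ} (ρlink : ℝ → ℝ) (y : Fin m → ℝ) : Prop where
  contDiff : ContDiff ℝ 1 ρlink
  injective : Function.Injective ρlink
  mem_image : ∀ j, ∃ x : ℝ, ρlink x = y j

/-- Assumption (A2) on the reparametrization `ρ : ℝ → D` with inverse `ρinv`:
continuously differentiable and invertible, derivative nonzero outside a finite set, and
`([ρ⁻¹]')²` integrable on every compact subset of `D`. -/
structure RepA2 (ρ : ℝ → ℝ) (D : Set ℝ) (ρinv : ℝ → ℝ) : Prop where
  contDiff : ContDiff ℝ 1 ρ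
  mapsTo : ∀ x : ℝ, ρ x ∈ D
  left_inv : ∀ x : ℝ, ρinv (ρ x) = x
  right_inv : ∀ z ∈ D, ρ (ρinv z) = z
  finite_critical : {x : ℝ | deriv ρ x = 0}.Finite
  loc_integrable : ∀ C : Set ℝ, C ⊆ D → IsCompact C →
    MeasureTheory.IntegrableOn (fun z => (deriv ρinv z) ^ 2) C

/-- A continuous injective function `ℝ → ℝ` is open at every point. -/
theorem image_mem_nhds_of_continuous_injective {f : ℝ → ℝ} (hf : Continuous f)
    (hinj : Function.Injective f) {x : ℝ} {U : Set ℝ} (hU : U ∈ 𝓝 x) : f '' U ∈ 𝓝 (f x) := by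
  obtain ⟨ε, hε, hεU⟩ := Metric.nhds_basis_closedBall.mem_iff.1 hU
  rw [Real.closedBall_eq_Icc] at hεU
  have hsub : uIcc (f (x - ε)) (f (x + ε)) ⊆ f '' U := by
    refine (intermediate_value_uIcc hf.continuousOn).trans (image_mono ?_)
    rwa [uIcc_of_le (by linarith)]
  refine mem_of_superset ?_ hsub
  rcases hf.strictMono_of_inj hinj with hm | hm
  · have h₁ : f (x - ε) < f x := hm (by linarith)
    have h₂ : f x < f (x + ε) := hm (by linarith)
    rw [uIcc_of_le (h₁.trans h₂).le]
    exact Icc_mem_nhds h₁ h₂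
  · have h₁ : f x < f (x - ε) := hm (by linarith)
    have h₂ : f (x + ε) < f x := hm (by linarith)
    rw [uIcc_of_ge (h₂.trans h₁).le]
    exact Icc_mem_nhds h₂ h₁

/-- A function continuous at `a` and differentiable near `a` with derivative `g` continuous at
`a` is differentiable at `a`. -/
theorem hasDerivAt_of_eventually_hasDerivAt_nhdsNE {f g : ℝ → ℝ} {a : ℝ}
    (hfg : ∀ᶠ x in 𝓝[≠] a, HasDerivAt f (g x) x) (hf : ContinuousAt f a)
    (hg : ContinuousAt g a) : HasDerivAt f (g a) a := by
  have hdiff : DifferentiableOn ℝ f {x | HasDerivAt f (g x) x} := fun x hx =>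
    (show HasDerivAt f (g x) x from hx).differentiableAt.differentiableWithinAt
  have hlim : Tendsto (deriv f) (𝓝[≠] a) (𝓝 (g a)) :=
    (hg.tendsto.mono_left nhdsWithin_le_nhds).congr' (hfg.mono fun x hx => hx.deriv.symm)
  have hgt : 𝓝[>] a ≤ 𝓝[≠] a := nhdsWithin_mono _ fun x hx => ne_of_gt hx
  have hlt : 𝓝[<] a ≤ 𝓝[≠] a := nhdsWithin_mono _ fun x hx => ne_of_lt hx
  have hr := hasDerivWithinAt_Ici_of_tendsto_deriv hdiff hf.continuousWithinAt (hgt hfg)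
    (hlim.mono_left hgt)
  have hl := hasDerivWithinAt_Iic_of_tendsto_deriv hdiff hf.continuousWithinAt (hlt hfg)
    (hlim.mono_left hlt)
  simpa [Ici_union_Iic] using hr.union hl

/-- The tangent inequality for a differentiable convex function. -/
theorem ConvexOn.fderiv_sub_le {E : Type*} [NormedAddCommGroup E] [NormedSpace ℝ E]
    {φ : E → ℝ} (hφ : ConvexOn ℝ univ φ) {q : E} (hd : DifferentiableAt ℝ φ q) (z : E) :
    fderiv ℝ φ q (z - q) ≤ φ z - φ q := by
  have hconv : ConvexOn ℝ univ (φ ∘ AffineMap.lineMap (k := ℝ) q z) := by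
    simpa using hφ.comp_affineMap (AffineMap.lineMap (k := ℝ) q z)
  have hline : HasDerivAt (AffineMap.lineMap (k := ℝ) q z) (z - q) (0 : ℝ) :=
    AffineMap.hasDerivAt_lineMap
  have hder : HasDerivAt (φ ∘ AffineMap.lineMap (k := ℝ) q z) (fderiv ℝ φ q (z - q)) 0 := by
    refine HasFDerivAt.comp_hasDerivAt (0 : ℝ) ?_ hline
    simpa using hd.hasFDerivAt
  have := hconv.le_slope_of_hasDerivAt (mem_univ 0) (mem_univ 1) one_pos hder
  simpa [slope_def_field] using this

/-- Chain rule for the gradient of a function precomposed with an entrywise map. -/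
theorem grad_comp_entrywise {k : ℕ} {φ : (Fin k → ℝ) → ℝ} {ρ : ℝ → ℝ} {x : Fin k → ℝ}
    (hφ : DifferentiableAt ℝ φ fun i => ρ (x i)) (hρ : Differentiable ℝ ρ) (i : Fin k) :
    grad (fun z => φ fun j => ρ (z j)) x i =
      deriv ρ (x i) * fderiv ℝ φ (fun j => ρ (x j)) (Pi.single i 1) := by
  have hin : HasFDerivAt (fun z : Fin k → ℝ => fun j => ρ (z j))
      (ContinuousLinearMap.pi fun j =>
        deriv ρ (x j) • ContinuousLinearMap.proj (R := ℝ) (φ := fun _ : Fin k => ℝ) j) x :=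
    hasFDerivAt_pi.2 fun j =>
      (hρ (x j)).hasDerivAt.comp_hasFDerivAt x (hasFDerivAt_apply j x)
  have hcomp := HasFDerivAt.comp (g := φ) x hφ.hasFDerivAt hin
  have hsingle : (fun j => deriv ρ (x j) * (Pi.single i 1 : Fin k → ℝ) j) =
      deriv ρ (x i) • (Pi.single i 1 : Fin k → ℝ) := by
    ext j
    by_cases hj : j = i
    · subst hj; simp
    · simp [hj]
  have hfd : fderiv ℝ (fun z : Fin k → ℝ => φ fun j => ρ (z j)) x = _ := hcomp.fderiv
  unfold grad
  rw [hfd, ContinuousLinearMap.comp_apply]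
  have harg : (ContinuousLinearMap.pi fun j =>
      deriv ρ (x j) • ContinuousLinearMap.proj (R := ℝ) (φ := fun _ : Fin k => ℝ) j)
        (Pi.single i 1) = deriv ρ (x i) • (Pi.single i 1 : Fin k → ℝ) := by
    rw [← hsingle]
    ext j
    simp
  rw [harg, map_smul, smul_eq_mul]

namespace RepA2

variable {ρ ρinv : ℝ → ℝ} {D : Set ℝ}

theorem injective (hA : RepA2 ρ D ρinv) : Function.Injective ρ :=
  Function.LeftInverse.injective hA.left_inv

theorem range_eq (hA : RepA2 ρ D ρinv) : range ρ = D :=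
  Subset.antisymm (range_subset_iff.2 hA.mapsTo) fun z hz => ⟨ρinv z, hA.right_inv z hz⟩

theorem ordConnected (hA : RepA2 ρ D ρinv) : D.OrdConnected :=
  hA.range_eq ▸ (isPreconnected_range hA.contDiff.continuous).ordConnected

theorem mem_nhds (hA : RepA2 ρ D ρinv) {z : ℝ} (hz : z ∈ D) : D ∈ 𝓝 z := by
  have := image_mem_nhds_of_continuous_injective hA.contDiff.continuous hA.injective
    (univ_mem : univ ∈ 𝓝 (ρinv z))
  rwa [image_univ, hA.range_eq, hA.right_inv z hz] at this

theorem continuousAt_inv (hA : RepA2 ρ D ρinv) {z : ℝ} (hz : z ∈ D) : ContinuousAt ρinv z := by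
  intro U hU
  have := image_mem_nhds_of_continuous_injective hA.contDiff.continuous hA.injective hU
  rw [hA.right_inv z hz] at this
  refine mem_map.2 (mem_of_superset this ?_)
  rintro _ ⟨x, hx, rfl⟩
  simpa [hA.left_inv] using hx

theorem hasDerivAt_inv (hA : RepA2 ρ D ρinv) {z : ℝ} (hz : z ∈ D)
    (hne : deriv ρ (ρinv z) ≠ 0) : HasDerivAt ρinv (deriv ρ (ρinv z))⁻¹ z :=
  HasDerivAt.of_local_left_inverse (hA.continuousAt_inv hz)
    (hA.contDiff.differentiable one_ne_zero _).hasDerivAt hne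
    (mem_of_superset (hA.mem_nhds hz) hA.right_inv)

/-- At the image of a noncritical point the antiderivative `h` is differentiable, even if the
point is in the exceptional set. -/
theorem hasDerivAt_antideriv (hA : RepA2 ρ D ρinv) {h : ℝ → ℝ} {S : Set ℝ} (hS : S.Finite)
    (hcont : ContinuousOn h D)
    (hderiv : ∀ z ∈ D \ S, HasDerivWithinAt h ((deriv ρinv z) ^ 2) D z) {x : ℝ}
    (hx : deriv ρ x ≠ 0) : HasDerivAt h (((deriv ρ x)⁻¹) ^ 2) (ρ x) := by
  have hD : D ∈ 𝓝 (ρ x) := hA.mem_nhds (hA.mapsTo x)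
  have hc : ContinuousAt (fun z => deriv ρ (ρinv z)) (ρ x) :=
    (hA.contDiff.continuous_deriv le_rfl).continuousAt.comp
      (hA.continuousAt_inv (hA.mapsTo x))
  have hx' : deriv ρ (ρinv (ρ x)) ≠ 0 := by rwa [hA.left_inv]
  have key := hasDerivAt_of_eventually_hasDerivAt_nhdsNE (f := h)
    (g := fun z => ((deriv ρ (ρinv z))⁻¹) ^ 2) (a := ρ x) ?_
    (hcont.continuousAt hD) ((hc.inv₀ hx').pow 2)
  · simpa only [hA.left_inv] using key
  · have hSev : ∀ᶠ z in 𝓝[≠] (ρ x), z ∉ S := by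
      have : (S \ {ρ x})ᶜ ∈ 𝓝 (ρ x) :=
        (hS.subset sdiff_subset).isClosed.isOpen_compl.mem_nhds (by simp)
      filter_upwards [mem_nhdsWithin_of_mem_nhds this, self_mem_nhdsWithin] with z hz hne hzS
      exact hz ⟨hzS, hne⟩
    filter_upwards [hSev, mem_nhdsWithin_of_mem_nhds hD,
      mem_nhdsWithin_of_mem_nhds (hc.eventually_ne hx')] with z hzS hzD hz
    have hd := (hderiv z ⟨hzD, hzS⟩).hasDerivAt (hA.mem_nhds hzD)
    rwa [(hA.hasDerivAt_inv hzD hz).deriv] at hd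

theorem monotoneOn_antideriv (hA : RepA2 ρ D ρinv) {h : ℝ → ℝ} {S : Set ℝ} (hS : S.Finite)
    (hcont : ContinuousOn h D)
    (hderiv : ∀ z ∈ D \ S, HasDerivWithinAt h ((deriv ρinv z) ^ 2) D z) : MonotoneOn h D := by
  intro a ha b hb hab
  have hsub : Icc a b ⊆ D := hA.ordConnected.out ha hb
  have hint : IntervalIntegrable (fun z => (deriv ρinv z) ^ 2) MeasureTheory.volume a b := by
    rw [intervalIntegrable_iff_integrableOn_Icc_of_le hab]
    exact hA.loc_integrable _ hsub isCompact_Icc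
  have heq := MeasureTheory.integral_eq_of_hasDerivAt_off_countable_of_le h _ hab
    hS.countable (hcont.mono hsub)
    (fun z hz => (hderiv z ⟨hsub (Ioo_subset_Icc_self hz.1), hz.2⟩).hasDerivAt
      (hA.mem_nhds (hsub (Ioo_subset_Icc_self hz.1)))) hint
  have hnn : 0 ≤ ∫ z in a..b, (deriv ρinv z) ^ 2 :=
    intervalIntegral.integral_nonneg hab fun z _ => sq_nonneg _
  linarith

end RepA2

/-- An antiderivative of a monotone function lies above its tangents. -/
theorem MonotoneOn.mul_sub_le_of_hasDerivAt {D : Set ℝ} (hD : D.OrdConnected) {H h : ℝ → ℝ}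
    (hmono : MonotoneOn h D) (hH : ∀ z ∈ D, HasDerivAt H (h z) z) {p q : ℝ} (hp : p ∈ D)
    (hq : q ∈ D) : h q * (p - q) ≤ H p - H q := by
  rcases lt_trichotomy p q with hpq | rfl | hpq
  · have hsub : Icc p q ⊆ D := hD.out hp hq
    obtain ⟨c, hc, hceq⟩ := exists_hasDerivAt_eq_slope H h hpq
      (fun z hz => (hH z (hsub hz)).continuousAt.continuousWithinAt)
      fun z hz => hH z (hsub (Ioo_subset_Icc_self hz))
    have hle := hmono (hsub (Ioo_subset_Icc_self hc)) hq hc.2.le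
    rw [hceq, div_le_iff₀ (sub_pos.2 hpq)] at hle
    linarith
  · simp
  · have hsub : Icc q p ⊆ D := hD.out hq hp
    obtain ⟨c, hc, hceq⟩ := exists_hasDerivAt_eq_slope H h hpq
      (fun z hz => (hH z (hsub hz)).continuousAt.continuousWithinAt)
      fun z hz => hH z (hsub (Ioo_subset_Icc_self hz))
    have hle := hmono hq (hsub (Ioo_subset_Icc_self hc)) hc.1.le
    rwa [hceq, le_div_iff₀ (sub_pos.2 hpq)] at hle

theorem bregman_nonneg {k : ℕ} {D : Set ℝ} (hD : D.OrdConnected) {H h : ℝ → ℝ}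
    (hmono : MonotoneOn h D) (hH : ∀ z ∈ D, HasDerivAt H (h z) z) {p q : Fin k → ℝ}
    (hp : ∀ i, p i ∈ D) (hq : ∀ i, q i ∈ D) : 0 ≤ bregman H h p q := by
  have := Finset.sum_le_sum fun i (_ : i ∈ Finset.univ) =>
    hmono.mul_sub_le_of_hasDerivAt hD hH (hp i) (hq i)
  rw [Finset.sum_sub_distrib] at this
  unfold bregman
  linarith

/-- Derivative of the Bregman divergence in its second argument along a curve. -/
theorem hasDerivAt_bregman {k : ℕ} {H h : ℝ → ℝ} {p : Fin k → ℝ} {q : ℝ → Fin k → ℝ}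
    {q' h' : Fin k → ℝ} {t : ℝ} (hq : ∀ i, HasDerivAt (fun s => q s i) (q' i) t)
    (hH : ∀ i, HasDerivAt H (h (q t i)) (q t i)) (hh : ∀ i, HasDerivAt h (h' i) (q t i)) :
    HasDerivAt (fun s => bregman H h p (q s)) (-∑ i, h' i * q' i * (p i - q t i)) t := by
  have h₁ : HasDerivAt (fun s => ∑ i, H (q s i)) (∑ i, h (q t i) * q' i) t :=
    HasDerivAt.fun_sum fun i _ => (hH i).comp t (hq i)
  have h₂ : HasDerivAt (fun s => ∑ i, h (q s i) * (p i - q s i))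
      (∑ i, (h' i * q' i * (p i - q t i) + h (q t i) * -q' i)) t :=
    HasDerivAt.fun_sum fun i _ => ((hh i).comp t (hq i)).mul ((hq i).const_sub (p i))
  convert! (h₁.const_sub (∑ i, H (p i))).sub h₂ using 1
  rw [Finset.sum_add_distrib]
  simp only [mul_neg, Finset.sum_neg_distrib]
  ring

/-- Along a gradient flow of a convex function reparametrized entrywise, the Bregman divergence
is differentiable at noncritical times, with derivative bounded by the loss gap. -/
theorem exists_hasDerivAt_bregman_le {k : ℕ} {ρ ρinv : ℝ → ℝ} {D : Set ℝ} (hA : RepA2 ρ D ρinv)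
    {φ : (Fin k → ℝ) → ℝ} (hφ : Differentiable ℝ φ) (hconv : ConvexOn ℝ univ φ)
    {h H : ℝ → ℝ} {S : Set ℝ} (hS : S.Finite) (hcont : ContinuousOn h D)
    (hderiv : ∀ z ∈ D \ S, HasDerivWithinAt h ((deriv ρinv z) ^ 2) D z)
    (hH : ∀ z ∈ D, HasDerivAt H (h z) z) {T : ℝ≥0∞} {w : ℝ → Fin k → ℝ}
    (hflow : IsGradFlowOn (fun z => φ fun i => ρ (z i)) T w) (p : Fin k → ℝ) {t : ℝ}
    (ht : 0 < t) (htT : ENNReal.ofReal t < T) (hne : ∀ i, deriv ρ (w t i) ≠ 0) :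
    ∃ d : ℝ, HasDerivAt (fun s => bregman H h p (fun i => ρ (w s i))) d t ∧
      d ≤ φ p - φ fun i => ρ (w t i) := by
  have hρ : Differentiable ℝ ρ := hA.contDiff.differentiable one_ne_zero
  have hw := hasDerivAt_pi.1 ((hflow t ht.le htT).hasDerivAt (Ici_mem_nhds ht))
  refine ⟨_, hasDerivAt_bregman (q := fun s i => ρ (w s i))
    (fun i => (hρ (w t i)).hasDerivAt.comp t (hw i))
    (fun i => hH _ (hA.mapsTo _))
    fun i => hA.hasDerivAt_antideriv hS hcont hderiv (hne i), ?_⟩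
  refine le_trans (le_of_eq ?_) (hconv.fderiv_sub_le (hφ _) p)
  conv_rhs => rw [pi_eq_sum_univ' (p - fun i => ρ (w t i)), map_sum]
  rw [← Finset.sum_neg_distrib]
  refine Finset.sum_congr rfl fun i _ => ?_
  have hi := hne i
  rw [map_smul, smul_eq_mul, Pi.neg_apply, grad_comp_entrywise (hφ _) hρ, Pi.sub_apply]
  field_simp

/-- A real function with nonpositive derivative, bounded below, at all large arguments
converges at infinity. -/
theorem exists_tendsto_atTop_of_hasDerivAt_nonpos {g : ℝ → ℝ} {t₀ b : ℝ}
    (hg : ∀ t > t₀, ∃ d, HasDerivAt g d t ∧ d ≤ 0) (hb : ∀ t > t₀, b ≤ g t) :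
    ∃ c, Tendsto g atTop (𝓝 c) := by
  have hanti : AntitoneOn g (Ioi t₀) := by
    refine antitoneOn_of_deriv_nonpos (convex_Ioi t₀) (fun t ht => ?_) (fun t ht => ?_) ?_
    · obtain ⟨d, hd, -⟩ := hg t ht
      exact hd.continuousAt.continuousWithinAt
    · rw [interior_Ioi] at ht
      obtain ⟨d, hd, -⟩ := hg t ht
      exact hd.differentiableAt.differentiableWithinAt
    · intro t ht
      rw [interior_Ioi] at ht
      obtain ⟨d, hd, hd0⟩ := hg t ht
      rwa [hd.deriv]
  have hmem : ∀ t, max t (t₀ + 1) > t₀ := fun t => lt_max_of_lt_right (lt_add_one t₀)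
  have hanti' : Antitone fun t => g (max t (t₀ + 1)) := fun s t hst =>
    hanti (hmem s) (hmem t) (max_le_max_right _ hst)
  have hbdd : BddBelow (range fun t => g (max t (t₀ + 1))) :=
    ⟨b, by rintro _ ⟨t, rfl⟩; exact hb _ (hmem t)⟩
  refine ⟨_, (tendsto_atTop_ciInf hanti' hbdd).congr' ?_⟩
  filter_upwards [eventually_ge_atTop (t₀ + 1)] with t ht
  rw [max_eq_left ht]

/-- Along the reparametrized flow, the Bregman divergence to any point of
`D_rp^N` decays at rate at least `𝓛̃(w̃(t)) - 𝓛̃(z̃)`; in particular, if `T = ∞` and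
`𝓛̃(z̃) = 0` it converges. -/
theorem statement5 {N M : ℕ} (ρ ρinv : ℝ → ℝ) (D : Set ℝ) (hA2 : RepA2 ρ D ρinv)
    (A : Matrix (Fin M) (Fin N) ℝ) (y : Fin M → ℝ)
    (L : (Fin M → ℝ) → (Fin M → ℝ) → ℝ) (hA3 : LossA3 L)
    (h H : ℝ → ℝ) (S : Set ℝ) (hS : S.Finite)
    (hcont : ContinuousOn h D) (hHcont : ContinuousOn H D)
    (hderiv : ∀ z ∈ D \ S, HasDerivWithinAt h ((deriv ρinv z) ^ 2) D z)
    (hHderiv : ∀ z ∈ D, HasDerivWithinAt H (h z) D z)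
    (T : ℝ≥0∞) (hT : 0 < T) (w : ℝ → Fin N → ℝ)
    (hflow : IsGradFlowOn (fun z => L (A.mulVec fun i => ρ (z i)) y) T w)
    (hreg : RegularFlow ρ T w) :
    (∀ zt : Fin N → ℝ, (∀ i, zt i ∈ D) →
      ∀ t : ℝ, 0 < t → ENNReal.ofReal t < T → (∀ i, deriv ρ (w t i) ≠ 0) →
        ∃ d : ℝ, HasDerivAt (fun s => bregman H h zt (fun i => ρ (w s i))) d t ∧
          d ≤ L (A.mulVec zt) y - L (A.mulVec fun i => ρ (w t i)) y) ∧
    (T = ⊤ → ∀ zt : Fin N → ℝ, (∀ i, zt i ∈ D) → L (A.mulVec zt) y = 0 →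
      ∃ c : ℝ, Tendsto (fun t => bregman H h zt (fun i => ρ (w t i))) atTop (𝓝 c)) := by
  have hφ : Differentiable ℝ fun z => L (A.mulVec z) y := by
    have hL : Differentiable ℝ fun u => L u y :=
      (hA3.contDiff.differentiable one_ne_zero).comp
        (differentiable_id.prodMk (differentiable_const y))
    exact hL.comp A.mulVecLin.toContinuousLinearMap.differentiable
  have hconv : ConvexOn ℝ univ fun z => L (A.mulVec z) y :=
    (hA3.convexOn_fst y).comp_linearMap A.mulVecLin
  have hH : ∀ z ∈ D, HasDerivAt H (h z) z := fun z hz =>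
    (hHderiv z hz).hasDerivAt (hA2.mem_nhds hz)
  have hmain := fun (zt : Fin N → ℝ) (t : ℝ) (ht : 0 < t) (htT : ENNReal.ofReal t < T)
      (hne : ∀ i, deriv ρ (w t i) ≠ 0) =>
    exists_hasDerivAt_bregman_le hA2 hφ hconv hS hcont hderiv hH hflow zt ht htT hne
  refine ⟨fun zt _ => hmain zt, ?_⟩
  rintro rfl zt hzt hzero
  obtain ⟨b, hb⟩ := hreg.bddAbove
  refine exists_tendsto_atTop_of_hasDerivAt_nonpos (t₀ := max b 0) (b := 0) (fun t ht => ?_)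
    fun t _ => bregman_nonneg hA2.ordConnected
      (hA2.monotoneOn_antideriv hS hcont hderiv) hH hzt fun i => hA2.mapsTo _
  have ht0 : 0 < t := (le_max_right b 0).trans_lt ht
  obtain ⟨d, hd, hle⟩ := hmain zt t ht0 ENNReal.ofReal_lt_top fun i hi =>
    ((le_max_left b 0).trans_lt ht).not_ge (hb ⟨ht0.le, ENNReal.ofReal_lt_top, i, hi⟩)
  exact ⟨d, hd, by linarith [hA3.nonneg (A.mulVec fun i => ρ (w t i)) y]⟩
end
end

section
/- Let w : [0,T) → ℝ^N with T < ∞ be a regular reparametrized gradient flow under Assumptions (B1), (A2), (A3), (B2). If sup_{t ∈ [0,T)} ‖w̃(t)‖₂ < ∞, then the limit w̃_T := lim_{t→T} w̃(t) exists. Moreover, either w̃_T lies on the boundary ∂(D_rp^N) and the trajectory w is maximal, or there exists ε > 0 such that w can be extended to a solution w : [0, T+ε) → ℝ^N of the gradient flow equation. -/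
open Filter Topology Set
open scoped ENNReal

noncomputable section

/-- A `C¹` vector field bounded by `C` on the unit ball about `x₀` has an integral curve from `x₀`
that stays in this ball up to time `δ`, as long as `C * δ ≤ 1`. -/
theorem exists_integralCurve_mem_closedBall {E : Type*} [NormedAddCommGroup E] [NormedSpace ℝ E]
    [FiniteDimensional ℝ E] {f : E → E} (hf : ContDiff ℝ 1 f) {x₀ : E} {C : NNReal}
    (hC : ∀ x ∈ Metric.closedBall x₀ 1, ‖f x‖ ≤ C) {δ : ℝ} (hδ : 0 ≤ δ) (hCδ : C * δ ≤ 1) :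
    ∃ α : ℝ → E, α 0 = x₀ ∧ ∀ t ∈ Icc 0 δ, α t ∈ Metric.closedBall x₀ 1 ∧
      HasDerivWithinAt α (f (α t)) (Icc 0 δ) t := by
  have : ProperSpace E := FiniteDimensional.proper ℝ E
  obtain ⟨K, hK⟩ := hf.contDiffOn.exists_lipschitzOnWith one_ne_zero
    (convex_closedBall x₀ 1) (isCompact_closedBall x₀ 1)
  have hm : C * max (δ - (⟨0, le_rfl, hδ⟩ : Icc 0 δ)) ((⟨0, le_rfl, hδ⟩ : Icc 0 δ) - 0)
      ≤ ((1 : NNReal) : ℝ) - (0 : NNReal) := by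
    simpa [hδ] using hCδ
  have hpl : IsPicardLindelof (fun _ => f) (⟨0, le_rfl, hδ⟩ : Icc 0 δ) x₀ 1 0 C K :=
    .of_time_independent (by simpa using hC) (by simpa using hK) hm
  have hx : x₀ ∈ Metric.closedBall x₀ ((0 : NNReal) : ℝ) := by simp
  obtain ⟨α, hα⟩ := ODE.FunSpace.exists_isFixedPt_next hpl hx
  have hball : ∀ t, α.compProj t ∈ Metric.closedBall x₀ ((1 : NNReal) : ℝ) := fun t =>
    α.compProj_mem_closedBall hm
  refine ⟨α.compProj, ?_, fun t ht => ⟨by simpa using hball t, ?_⟩⟩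
  · exact ODE.FunSpace.compProj_val.trans α.apply_of_zero
  · refine (ODE.hasDerivWithinAt_picard_Icc (t₀ := 0) ⟨le_rfl, hδ⟩ hpl.continuousOn_uncurry
      α.continuous_compProj.continuousOn (fun u _ => hball u) x₀ ht).congr_of_mem
      (fun u hu => ?_) ht
    rw [ODE.FunSpace.compProj_of_mem hu]
    conv_lhs => rw [← hα]
    rfl

/-- **Peano existence theorem** for autonomous equations. -/
theorem exists_integralCurve_of_continuous {E : Type*} [NormedAddCommGroup E] [NormedSpace ℝ E]
    [FiniteDimensional ℝ E] {f : E → E} (hf : Continuous f) (x₀ : E) :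
    ∃ δ > 0, ∃ α : ℝ → E, α 0 = x₀ ∧
      ∀ t ∈ Icc 0 δ, HasDerivWithinAt α (f (α t)) (Icc 0 δ) t := by
  have : ProperSpace E := FiniteDimensional.proper ℝ E
  obtain ⟨B, hB⟩ := (isCompact_closedBall x₀ 1).exists_bound_of_continuousOn hf.continuousOn
  have hB0 : 0 ≤ B := (norm_nonneg _).trans (hB x₀ (by simp))
  lift B to NNReal using hB0
  set C : NNReal := B + 1 with hCdef
  have hC0 : (0 : ℝ) < C := by positivity
  have happrox : ∀ n : ℕ, ∃ g : E → E, ContDiff ℝ 1 g ∧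
      ∀ x, dist (g x) (f x) < 1 / ((n : ℝ) + 1) := fun n => by
    obtain ⟨g, hg, hgf, -⟩ := hf.exists_contDiff_approx (ε := fun _ => 1 / ((n : ℝ) + 1)) 1
      continuous_const (fun _ => Nat.one_div_pos_of_nat)
    exact ⟨g, hg, hgf⟩
  choose g hg hgf using happrox
  set δ : ℝ := 1 / C with hδdef
  have hδ : 0 < δ := by positivity
  have hgC : ∀ n, ∀ x ∈ Metric.closedBall x₀ 1, ‖g n x‖ ≤ C := fun n x hx => by
    have h1 := norm_le_norm_add_norm_sub' (g n x) (f x)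
    have h2 : ‖g n x - f x‖ ≤ 1 := by
      rw [← dist_eq_norm]
      refine (hgf n x).le.trans ?_
      rw [div_le_one (by positivity)]
      linarith [n.cast_nonneg (α := ℝ)]
    have h3 : (C : ℝ) = B + 1 := by simp [hCdef]
    linarith [hB x hx]
  have hCδ : C * δ ≤ 1 := (mul_one_div_cancel hC0.ne').le
  choose α hα0 hα using fun n : ℕ =>
    exists_integralCurve_mem_closedBall (hg n) (hgC n) hδ.le hCδ
  let U : Ultrafilter ℕ := hyperfilter ℕ
  have hU : (U : Filter ℕ) ≤ atTop := Nat.hyperfilter_le_atTop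
  have hlim : ∀ t, ∃ x, t ∈ Icc 0 δ → Tendsto (fun n => α n t) U (𝓝 x) := fun t => by
    by_cases ht : t ∈ Icc 0 δ
    · obtain ⟨x, -, hx⟩ := (isCompact_closedBall x₀ 1).ultrafilter_le_nhds
        (U.map fun n => α n t) (by
          rw [le_principal_iff]
          exact Filter.Eventually.of_forall (f := (U : Filter ℕ)) fun n => (hα n t ht).1)
      exact ⟨x, fun _ => hx⟩
    · exact ⟨x₀, fun h => absurd h ht⟩
  choose a ha using hlim
  refine ⟨δ, hδ, a, ?_, fun s hs => ?_⟩
  · refine tendsto_nhds_unique (ha 0 ⟨le_rfl, hδ.le⟩) ?_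
    simp only [hα0]
    exact tendsto_const_nhds
  rw [hasDerivWithinAt_iff_isLittleO, Asymptotics.isLittleO_iff]
  intro c hc
  obtain ⟨r, hr, hfr⟩ := Metric.continuousAt_iff.1 (hf.continuousAt (x := a s)) (c / 2)
    (half_pos hc)
  have hη : 0 < r / 2 / C := by positivity
  have hsmall : ∀ᶠ n : ℕ in (U : Filter ℕ), 1 / ((n : ℝ) + 1) < c / 2 :=
    hU (tendsto_one_div_add_atTop_nhds_zero_nat.eventually_lt_const (half_pos hc))
  have hnear : ∀ᶠ n in (U : Filter ℕ), dist (α n s) (a s) < r / 2 :=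
    (ha s hs).eventually (Metric.ball_mem_nhds _ (half_pos hr))
  filter_upwards [inter_mem self_mem_nhdsWithin
    (mem_nhdsWithin_of_mem_nhds (Metric.ball_mem_nhds s hη))] with t ht
  refine le_of_tendsto (f := fun n => ‖α n t - α n s - (t - s) • f (a s)‖)
    ((((ha t ht.1).sub (ha s hs)).sub_const _).norm) ?_
  filter_upwards [hsmall, hnear] with n hn1 hn2
  have hconv : Convex ℝ (Icc 0 δ ∩ Metric.ball s (r / 2 / C)) :=
    (convex_Icc 0 δ).inter (convex_ball s _)
  have hsS : s ∈ Icc 0 δ ∩ Metric.ball s (r / 2 / C) := ⟨hs, Metric.mem_ball_self hη⟩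
  have hbound : ∀ u ∈ Icc 0 δ ∩ Metric.ball s (r / 2 / C),
      ‖g n (α n u) - (1 : ℝ) • f (a s)‖ ≤ c := fun u hu => by
    have h1 : ‖α n u - α n s‖ ≤ C * ‖u - s‖ :=
      (convex_Icc 0 δ).norm_image_sub_le_of_norm_hasDerivWithin_le
        (fun v hv => (hα n v hv).2) (fun v hv => hgC n _ (hα n v hv).1) hs hu.1
    have h2 : C * ‖u - s‖ < r / 2 := by
      have := hu.2
      rw [Metric.mem_ball, dist_eq_norm, lt_div_iff₀ hC0] at this
      linarith
    have h3 : dist (α n u) (a s) < r := by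
      have := dist_triangle (α n u) (α n s) (a s)
      rw [dist_eq_norm (α n u) (α n s)] at this
      linarith
    have h4 := dist_triangle (g n (α n u)) (f (α n u)) (f (a s))
    rw [one_smul, ← dist_eq_norm]
    linarith [hfr h3, hgf n (α n u)]
  have hmv := hconv.norm_image_sub_le_of_norm_hasDerivWithin_le
    (f := fun u => α n u - u • f (a s))
    (fun u hu => ((hα n u hu.1).2.mono inter_subset_left).sub
      ((hasDerivWithinAt_id u _).smul_const (f (a s)))) hbound hsS ht
  have hrw : α n t - α n s - (t - s) • f (a s) =
      α n t - t • f (a s) - (α n s - s • f (a s)) := by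
    rw [sub_smul]
    abel
  rw [hrw]
  exact hmv

/-- An integral curve on `[0, T)` of a continuous vector field that converges as `t → T` extends
to an integral curve past `T`. -/
theorem exists_extension_of_tendsto {E : Type*} [NormedAddCommGroup E] [NormedSpace ℝ E]
    [FiniteDimensional ℝ E] {f : E → E} (hf : Continuous f) {T : ℝ} (hT : 0 < T) {w : ℝ → E}
    (hw : ∀ t, 0 ≤ t → t < T → HasDerivWithinAt w (f (w t)) (Ici 0) t) {x : E}
    (hx : Tendsto w (𝓝[<] T) (𝓝 x)) :
    ∃ ε > 0, ∃ v : ℝ → E, (∀ t, t < T → v t = w t) ∧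
      ∀ t, 0 ≤ t → t < T + ε → HasDerivWithinAt v (f (v t)) (Ici 0) t := by
  obtain ⟨δ, hδ, α, hα0, hα⟩ := exists_integralCurve_of_continuous hf x
  let v : ℝ → E := fun t => if t < T then w t else α (t - T)
  have hvlt : ∀ t, t < T → v t = w t := fun t ht => if_pos ht
  have hvge : ∀ t, T ≤ t → v t = α (t - T) := fun t ht => if_neg ht.not_gt
  have hvT : v T = x := by rw [hvge T le_rfl, sub_self, hα0]
  have hlt : ∀ t, 0 ≤ t → t < T → HasDerivWithinAt v (f (v t)) (Ici 0) t := fun t h0 ht => by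
    rw [hvlt t ht]
    refine (hw t h0 ht).congr_of_eventuallyEq ?_ (hvlt t ht)
    filter_upwards [mem_nhdsWithin_of_mem_nhds (Iio_mem_nhds ht)] with u hu using hvlt u hu
  have hltAt : ∀ t, 0 < t → t < T → HasDerivAt v (f (v t)) t := fun t h0 ht =>
    (hlt t h0.le ht).hasDerivAt (Ici_mem_nhds h0)
  have hvx : Tendsto v (𝓝[<] T) (𝓝 x) :=
    hx.congr' (by filter_upwards [self_mem_nhdsWithin] with u hu using (hvlt u hu).symm)
  have hright : ∀ t, T ≤ t → t < T + δ → HasDerivWithinAt v (f (v t)) (Ici T) t :=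
    fun t h0 ht => by
    have h1 : HasDerivWithinAt (fun u => α (u - T)) (f (α (t - T))) (Icc T (T + δ)) t := by
      have h2 := (hα (t - T) ⟨by linarith, by linarith⟩).scomp t
        (h := fun u => u - T) (s := Icc T (T + δ))
        ((hasDerivWithinAt_id t _).sub_const T)
        (fun u hu => ⟨by linarith [hu.1], by linarith [hu.2]⟩)
      simpa [Function.comp_def] using h2
    have h3 : HasDerivWithinAt v (f (v t)) (Icc T (T + δ)) t := by
      rw [hvge t h0]
      exact h1.congr (fun u hu => hvge u hu.1) (hvge t h0)
    refine h3.mono_of_mem_nhdsWithin ?_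
    rw [← Ici_inter_Iic]
    exact inter_mem self_mem_nhdsWithin (mem_nhdsWithin_of_mem_nhds (Iic_mem_nhds ht))
  have hmem : Ioo 0 T ∈ 𝓝[<] T := Ioo_mem_nhdsLT hT
  have hleft : HasDerivWithinAt v (f (v T)) (Iic T) T := by
    refine hasDerivWithinAt_Iic_of_tendsto_deriv (s := Ioo 0 T)
      (fun u hu => (hltAt u hu.1 hu.2).differentiableAt.differentiableWithinAt) ?_ hmem ?_
    · rw [ContinuousWithinAt, hvT]
      exact hvx.mono_left (nhdsWithin_mono T fun u hu => hu.2)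
    · rw [hvT]
      refine ((hf.tendsto x).comp hvx).congr' ?_
      filter_upwards [hmem] with u hu using (hltAt u hu.1 hu.2).deriv.symm
  refine ⟨δ, hδ, v, hvlt, fun t h0 ht => ?_⟩
  rcases lt_trichotomy t T with h | rfl | h
  · exact hlt t h0 h
  · exact (hleft.union (hright t le_rfl ht)).mono (by simp [Iic_union_Ici])
  · exact ((hright t h.le ht).hasDerivAt (Ici_mem_nhds h)).hasDerivWithinAt

/-- Along a gradient flow, the objective decreases at rate `‖∇F‖₂²`. -/
theorem hasDerivAt_comp_gradFlow {k : ℕ} {F : (Fin k → ℝ) → ℝ} {w : ℝ → Fin k → ℝ} {t : ℝ}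
    (hF : DifferentiableAt ℝ F (w t)) (hw : HasDerivAt w (-(grad F (w t))) t) :
    HasDerivAt (fun s => F (w s)) (-∑ i, grad F (w t) i ^ 2) t := by
  have h : fderiv ℝ F (w t) (-(grad F (w t))) = -∑ i, grad F (w t) i ^ 2 := by
    rw [map_neg, neg_inj]
    conv_lhs => rw [pi_eq_sum_univ' (grad F (w t)), map_sum]
    refine Finset.sum_congr rfl fun i _ => ?_
    rw [map_smul, smul_eq_mul, sq]
    congr 2
  rw [← h]
  exact hF.hasFDerivAt.comp_hasDerivAt t hw

/-- A function on `[a, b)` whose derivative is dominated in absolute value by that of a bounded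
function has a limit at `b`. -/
theorem exists_tendsto_of_abs_deriv_le {a b : ℝ} (hab : a < b) {x x' G G' : ℝ → ℝ} {B : ℝ}
    (hx : ∀ t ∈ Ico a b, HasDerivAt x (x' t) t) (hG : ∀ t ∈ Ico a b, HasDerivAt G (G' t) t)
    (hle : ∀ t ∈ Ico a b, |x' t| ≤ G' t) (hB : ∀ t ∈ Ico a b, G t ≤ B) :
    ∃ l, Tendsto x (𝓝[<] b) (𝓝 l) := by
  have hmono : ∀ {h h' : ℝ → ℝ}, (∀ t ∈ Ico a b, HasDerivAt h (h' t) t) →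
      (∀ t ∈ Ico a b, 0 ≤ h' t) → MonotoneOn h (Ico a b) := fun hh hn =>
    monotoneOn_of_deriv_nonneg (convex_Ico a b)
      (fun t ht => (hh t ht).continuousAt.continuousWithinAt)
      (fun t ht => (hh t (interior_subset ht)).differentiableAt.differentiableWithinAt)
      (fun t ht => by rw [(hh t (interior_subset ht)).deriv]; exact hn t (interior_subset ht))
  have hlim : ∀ {h : ℝ → ℝ} {c : ℝ}, MonotoneOn h (Ico a b) → (∀ t ∈ Ico a b, h t ≤ c) →
      ∃ l, Tendsto h (𝓝[<] b) (𝓝 l) := fun hm hc =>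
    ⟨_, (hm.mono Ioo_subset_Ico_self).tendsto_nhdsWithin_Ioo_left (nonempty_Ioo.2 hab)
      ⟨_, by rintro _ ⟨t, ht, rfl⟩; exact hc t (Ioo_subset_Ico_self ht)⟩⟩
  have hGm : MonotoneOn G (Ico a b) := hmono hG fun t ht => (abs_nonneg _).trans (hle t ht)
  have hplus : MonotoneOn (fun t => G t + x t) (Ico a b) :=
    hmono (fun t ht => (hG t ht).add (hx t ht)) fun t ht => by
      linarith [neg_abs_le (x' t), hle t ht]
  have hminus : MonotoneOn (fun t => G t - x t) (Ico a b) :=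
    hmono (fun t ht => (hG t ht).sub (hx t ht)) fun t ht => by
      linarith [le_abs_self (x' t), hle t ht]
  obtain ⟨l₁, hl₁⟩ := hlim hGm hB
  obtain ⟨l₂, hl₂⟩ := hlim (c := 2 * B - (G a - x a)) hplus fun t ht => by
    have := hminus ⟨le_rfl, hab⟩ ht ht.1
    simp only at this
    linarith [hB t ht]
  exact ⟨l₂ - l₁, by simpa using hl₂.sub hl₁⟩

/-- A gradient flow on a bounded time interval `[0, T)` of a function bounded below converges
as `t → T`. -/
theorem exists_tendsto_gradFlow {k : ℕ} {F : (Fin k → ℝ) → ℝ} (hF : Differentiable ℝ F)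
    (hF0 : ∀ z, 0 ≤ F z) {T : ℝ} (hT : 0 < T) {w : ℝ → Fin k → ℝ}
    (hw : ∀ t, 0 ≤ t → t < T → HasDerivWithinAt w (-(grad F (w t))) (Ici 0) t) :
    ∃ x, Tendsto w (𝓝[<] T) (𝓝 x) := by
  have hw' : ∀ t ∈ Ico (T / 2) T, HasDerivAt w (-(grad F (w t))) t := fun t ht =>
    have h0 : 0 < t := by linarith [ht.1]
    (hw t h0.le ht.2).hasDerivAt (Ici_mem_nhds h0)
  have hcoord : ∀ i, ∃ l, Tendsto (fun t => w t i) (𝓝[<] T) (𝓝 l) := fun i =>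
    exists_tendsto_of_abs_deriv_le (half_lt_self hT) (B := T)
      (G := fun t => t - F (w t)) (fun t ht => (hasDerivAt_pi.1 (hw' t ht)) i)
      (fun t ht => (hasDerivAt_id t).sub (hasDerivAt_comp_gradFlow (hF _) (hw' t ht)))
      (fun t _ => by
        have h1 : grad F (w t) i ^ 2 ≤ ∑ j, grad F (w t) j ^ 2 :=
          Finset.single_le_sum (f := fun j => grad F (w t) j ^ 2)
            (fun j _ => sq_nonneg _) (Finset.mem_univ i)
        rw [Pi.neg_apply, abs_neg]
        nlinarith [sq_abs (grad F (w t) i), sq_nonneg (|grad F (w t) i| - 1 / 2)])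
      (fun t ht => by linarith [hF0 (w t), ht.2])
  choose l hl using hcoord
  exact ⟨l, tendsto_pi_nhds.2 hl⟩

/-- A bounded reparametrized trajectory on finite `[0,T)` has a limit at
`T`; moreover either the limit is on the boundary of `D_rp^N` and the trajectory is
maximal, or the flow extends past `T`. -/
theorem statement8 {N M : ℕ} (ρ ρinv : ℝ → ℝ) (D : Set ℝ) (hA2 : RepA2 ρ D ρinv)
    (A : Matrix (Fin M) (Fin N) ℝ) (y : Fin M → ℝ)
    (L : (Fin M → ℝ) → (Fin M → ℝ) → ℝ) (hA3 : LossA3 L)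
    (zt0 : Fin N → ℝ) (hzt0mem : ∀ i, zt0 i ∈ D) (hzt0 : A.mulVec zt0 = y)
    (T : ℝ≥0∞) (hT : 0 < T) (hTfin : T ≠ ⊤) (w : ℝ → Fin N → ℝ)
    (hflow : IsGradFlowOn (fun z => L (A.mulVec fun i => ρ (z i)) y) T w)
    (hreg : RegularFlow ρ T w)
    (hbdd : ∃ C : ℝ, ∀ t : ℝ, 0 ≤ t → ENNReal.ofReal t < T →
      euclNorm (fun i => ρ (w t i)) ≤ C) :
    ∃ wT : Fin N → ℝ,
      Tendsto (fun t => fun i => ρ (w t i)) (endFilter T) (𝓝 wT) ∧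
      ((wT ∈ frontier {z : Fin N → ℝ | ∀ i, z i ∈ D} ∧
          ¬ ∃ ε : ℝ, 0 < ε ∧ ∃ w2 : ℝ → Fin N → ℝ,
            IsGradFlowOn (fun z => L (A.mulVec fun i => ρ (z i)) y)
              (T + ENNReal.ofReal ε) w2 ∧
            ∀ t : ℝ, 0 ≤ t → ENNReal.ofReal t < T → w2 t = w t) ∨
        (∃ ε : ℝ, 0 < ε ∧ ∃ w2 : ℝ → Fin N → ℝ,
          IsGradFlowOn (fun z => L (A.mulVec fun i => ρ (z i)) y)
            (T + ENNReal.ofReal ε) w2 ∧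
          ∀ t : ℝ, 0 ≤ t → ENNReal.ofReal t < T → w2 t = w t)) := by
  have hT' : 0 < T.toReal := ENNReal.toReal_pos hT.ne' hTfin
  set F : (Fin N → ℝ) → ℝ := fun z => L (A.mulVec fun i => ρ (z i)) y
  have hF : ContDiff ℝ 1 F := by
    have h1 : ContDiff ℝ 1 fun z : Fin N → ℝ => A.mulVec fun i => ρ (z i) :=
      A.mulVecLin.toContinuousLinearMap.contDiff.comp
        (contDiff_pi.2 fun i => hA2.contDiff.comp (contDiff_apply ℝ ℝ i))
    exact hA3.contDiff.comp (h1.prodMk contDiff_const)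
  have hgrad : Continuous fun x => -(grad F x) :=
    (continuous_pi fun i => (hF.continuous_fderiv one_ne_zero).clm_apply continuous_const).neg
  have hw : ∀ t, 0 ≤ t → t < T.toReal → HasDerivWithinAt w (-(grad F (w t))) (Ici 0) t :=
    fun t h0 ht => hflow t h0 ((ENNReal.ofReal_lt_iff_lt_toReal h0 hTfin).2 ht)
  obtain ⟨x, hx⟩ := exists_tendsto_gradFlow (hF.differentiable one_ne_zero)
    (fun z => hA3.nonneg _ _) hT' hw
  refine ⟨fun i => ρ (x i), ?_, Or.inr ?_⟩
  · rw [endFilter, if_neg hTfin]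
    exact tendsto_pi_nhds.2 fun i =>
      (hA2.contDiff.continuous.tendsto _).comp ((tendsto_pi_nhds.1 hx) i)
  · obtain ⟨ε, hε, v, hvw, hv⟩ := exists_extension_of_tendsto hgrad hT' hw hx
    refine ⟨ε, hε, v, fun t h0 ht => hv t h0 ?_, fun t h0 ht =>
      hvw t ((ENNReal.ofReal_lt_iff_lt_toReal h0 hTfin).1 ht)⟩
    rwa [ENNReal.ofReal_lt_iff_lt_toReal h0 (by finiteness),
      ENNReal.toReal_add hTfin ENNReal.ofReal_ne_top, ENNReal.toReal_ofReal hε.le] at ht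
end
end
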